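/- arXiv:2509.24710 — 4 statements merged into one kernel-verified Lean document; each statement's English description precedes it below -/
import Mathlib

section
/- Let p : ℝ^d → ℝ be a continuously differentiable probability density with p(x) > 0 for all x, such that p and each component of ∇p are bounded and continuous. Then for every x ∈ ℝ^d, the extended score of p at x converges to the score of p at x: lim_{γ→0} [(1+γ)·∇_x log(p*g_γ)(x) + γ·(d/dγ)∇_x log(p*g_γ)(x)] = ∇ log p(x). -/
open MeasureTheory Filter Real Topology

/-- The density of the Gaussian `N(0, γ I)` on `ℝ^d`. -/
noncomputable def gaussDensity (d : ℕ) (γ : ℝ) (x : EuclideanSpace ℝ (Fin d)) : ℝ :=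
  (2 * π * γ) ^ (-(d : ℝ) / 2) * Real.exp (-‖x‖ ^ 2 / (2 * γ))

/-- Convolution `(p * g_γ)(x) = ∫ p(y) g_γ(x - y) dy` of a density with the Gaussian. -/
noncomputable def gaussConv (d : ℕ) (p : EuclideanSpace ℝ (Fin d) → ℝ) (γ : ℝ)
    (x : EuclideanSpace ℝ (Fin d)) : ℝ :=
  ∫ y, p y * gaussDensity d γ (x - y)

section GaussianSmoothing

variable {d : ℕ}

theorem continuous_gaussDensity (γ : ℝ) : Continuous (gaussDensity d γ) := by
  unfold gaussDensity
  fun_prop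

theorem integrable_exp_neg_mul_norm_sq {b : ℝ} (hb : 0 < b) :
    Integrable (fun v : EuclideanSpace ℝ (Fin d) => Real.exp (-b * ‖v‖ ^ 2)) := by
  apply Integrable.of_integral_ne_zero
  rw [GaussianFourier.integral_rexp_neg_mul_sq_norm hb]
  positivity

theorem integrable_norm_sq_mul_exp {b : ℝ} (hb : 0 < b) :
    Integrable (fun v : EuclideanSpace ℝ (Fin d) => ‖v‖ ^ 2 * Real.exp (-b * ‖v‖ ^ 2)) := by
  refine ((integrable_exp_neg_mul_norm_sq (d := d) (half_pos hb)).const_mul (2 / b)).mono'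
    (by fun_prop) (Eventually.of_forall fun v => ?_)
  rw [Real.norm_of_nonneg (by positivity)]
  have h1 : b / 2 * ‖v‖ ^ 2 ≤ Real.exp (b / 2 * ‖v‖ ^ 2) := by
    linarith [Real.add_one_le_exp (b / 2 * ‖v‖ ^ 2)]
  have h2 : ‖v‖ ^ 2 ≤ 2 / b * Real.exp (b / 2 * ‖v‖ ^ 2) := by
    calc ‖v‖ ^ 2 = 2 / b * (b / 2 * ‖v‖ ^ 2) := by field_simp
      _ ≤ _ := by gcongr
  calc ‖v‖ ^ 2 * Real.exp (-b * ‖v‖ ^ 2)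
      ≤ 2 / b * Real.exp (b / 2 * ‖v‖ ^ 2) * Real.exp (-b * ‖v‖ ^ 2) := by gcongr
    _ = 2 / b * Real.exp (-(b / 2) * ‖v‖ ^ 2) := by
      rw [mul_assoc, ← Real.exp_add]; ring_nf

theorem neg_norm_sq_div (γ : ℝ) (v : EuclideanSpace ℝ (Fin d)) :
    -‖v‖ ^ 2 / (2 * γ) = -(1 / (2 * γ)) * ‖v‖ ^ 2 := by ring

theorem integrable_gaussDensity {γ : ℝ} (hγ : 0 < γ) : Integrable (gaussDensity d γ) := by
  unfold gaussDensity
  simp_rw [neg_norm_sq_div]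
  exact (integrable_exp_neg_mul_norm_sq (by positivity)).const_mul _

theorem integral_gaussDensity {γ : ℝ} (hγ : 0 < γ) : ∫ v, gaussDensity d γ v = 1 := by
  unfold gaussDensity
  simp_rw [neg_norm_sq_div]
  rw [integral_const_mul, GaussianFourier.integral_rexp_neg_mul_sq_norm (by positivity)]
  have h : π / (1 / (2 * γ)) = 2 * π * γ := by field_simp
  rw [h, finrank_euclideanSpace_fin, ← Real.rpow_add (by positivity), neg_div, neg_add_cancel,
    Real.rpow_zero]

/-- The derivative of `gaussDensity d γ v` with respect to the parameter `γ`. -/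
noncomputable def gaussDensityDeriv (d : ℕ) (γ : ℝ) (v : EuclideanSpace ℝ (Fin d)) : ℝ :=
  (-(d : ℝ) / (2 * γ) + ‖v‖ ^ 2 / (2 * γ ^ 2)) * gaussDensity d γ v

theorem hasDerivAt_gaussDensity {γ : ℝ} (hγ : 0 < γ) (v : EuclideanSpace ℝ (Fin d)) :
    HasDerivAt (fun s => gaussDensity d s v) (gaussDensityDeriv d γ v) γ := by
  have h1 : HasDerivAt (fun s : ℝ => 2 * π * s) (2 * π) γ := by
    simpa using (hasDerivAt_id γ).const_mul (2 * π)
  have h2 := h1.rpow_const (p := -(d : ℝ) / 2) (Or.inl (by positivity))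
  have h3 : HasDerivAt (fun s : ℝ => 2 * s) 2 γ := by
    simpa using (hasDerivAt_id γ).const_mul (2 : ℝ)
  have h4 := ((hasDerivAt_const γ (-‖v‖ ^ 2)).div h3 (by positivity)).exp
  refine (h2.mul h4).congr_deriv ?_
  unfold gaussDensityDeriv gaussDensity
  rw [Real.rpow_sub_one (by positivity)]
  simp only [Pi.div_apply]
  field_simp
  ring

theorem continuous_gaussDensityDeriv (γ : ℝ) : Continuous (gaussDensityDeriv d γ) := by
  have := continuous_gaussDensity (d := d) γ
  unfold gaussDensityDeriv
  fun_prop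

/-- A bound for `gaussDensityDeriv d s` which is uniform in `s ∈ (γ / 2, 2 * γ)`. -/
noncomputable def gaussDensityDerivBound (d : ℕ) (γ : ℝ) (v : EuclideanSpace ℝ (Fin d)) : ℝ :=
  (d / γ + 2 / γ ^ 2 * ‖v‖ ^ 2) * ((π * γ) ^ (-(d : ℝ) / 2) * Real.exp (-(1 / (4 * γ)) * ‖v‖ ^ 2))

theorem integrable_gaussDensityDerivBound {γ : ℝ} (hγ : 0 < γ) :
    Integrable (gaussDensityDerivBound d γ) := by
  have h1 := (integrable_exp_neg_mul_norm_sq (d := d) (b := 1 / (4 * γ)) (by positivity)).const_mul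
    (d / γ * (π * γ) ^ (-(d : ℝ) / 2))
  have h2 := (integrable_norm_sq_mul_exp (d := d) (b := 1 / (4 * γ)) (by positivity)).const_mul
    (2 / γ ^ 2 * (π * γ) ^ (-(d : ℝ) / 2))
  refine (h1.add h2).congr (Eventually.of_forall fun v => ?_)
  simp only [gaussDensityDerivBound, Pi.add_apply]
  ring

theorem abs_gaussDensityDeriv_le {γ s : ℝ} (hγ : 0 < γ) (hs : s ∈ Set.Ioo (γ / 2) (2 * γ))
    (v : EuclideanSpace ℝ (Fin d)) :
    |gaussDensityDeriv d s v| ≤ gaussDensityDerivBound d γ v := by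
  obtain ⟨hs1, hs2⟩ := hs
  have hs0 : 0 < s := by linarith
  unfold gaussDensityDeriv gaussDensityDerivBound gaussDensity
  rw [abs_mul, abs_of_nonneg (a := (_ ^ _ * _)) (by positivity)]
  have hA : |-(d : ℝ) / (2 * s) + ‖v‖ ^ 2 / (2 * s ^ 2)| ≤ d / γ + 2 / γ ^ 2 * ‖v‖ ^ 2 := by
    refine (abs_add_le _ _).trans (add_le_add ?_ ?_)
    · rw [neg_div, abs_neg, abs_of_nonneg (by positivity)]
      gcongr
      linarith
    · rw [abs_of_nonneg (by positivity), div_eq_mul_inv, mul_comm]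
      gcongr
      rw [inv_eq_one_div, div_le_div_iff₀ (by positivity) (by positivity)]
      nlinarith
  have hB : (2 * π * s) ^ (-(d : ℝ) / 2) ≤ (π * γ) ^ (-(d : ℝ) / 2) := by
    apply Real.rpow_le_rpow_of_nonpos (by positivity)
    · nlinarith [Real.pi_pos]
    · rw [neg_div]
      exact neg_nonpos.mpr (by positivity)
  have hC : -‖v‖ ^ 2 / (2 * s) ≤ -(1 / (4 * γ)) * ‖v‖ ^ 2 := by
    rw [neg_norm_sq_div]
    have h : 1 / (4 * γ) ≤ 1 / (2 * s) := one_div_le_one_div_of_le (by positivity) (by linarith)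
    exact mul_le_mul_of_nonneg_right (neg_le_neg h) (by positivity)
  gcongr

theorem integrable_gaussDensityDeriv {γ : ℝ} (hγ : 0 < γ) :
    Integrable (gaussDensityDeriv d γ) :=
  (integrable_gaussDensityDerivBound hγ).mono' (continuous_gaussDensityDeriv γ).aestronglyMeasurable
    (Eventually.of_forall fun v =>
      abs_gaussDensityDeriv_le hγ ⟨by linarith, by linarith⟩ v)

variable {E : Type*} [NormedAddCommGroup E] [NormedSpace ℝ E]

theorem MeasureTheory.Integrable.smul_of_bounded_continuous
    {k : EuclideanSpace ℝ (Fin d) → ℝ} (hk : Integrable k)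
    {f : EuclideanSpace ℝ (Fin d) → E} (hf : Continuous f) {C : ℝ} (hC : ∀ y, ‖f y‖ ≤ C) :
    Integrable (fun y => k y • f y) :=
  hk.smul_bdd C hf.aestronglyMeasurable (Eventually.of_forall hC)

/-- Differentiation under the integral of a Gaussian average with respect to the variance. -/
theorem hasDerivAt_integral_gaussDensity_smul {f : EuclideanSpace ℝ (Fin d) → E}
    (hf : Continuous f) {C : ℝ} (hC : ∀ y, ‖f y‖ ≤ C) {γ : ℝ} (hγ : 0 < γ) :
    HasDerivAt (fun s => ∫ y, gaussDensity d s y • f y)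
      (∫ y, gaussDensityDeriv d γ y • f y) γ := by
  have hC0 : 0 ≤ C := (norm_nonneg _).trans (hC 0)
  refine (hasDerivAt_integral_of_dominated_loc_of_deriv_le
    (F := fun s y => gaussDensity d s y • f y) (F' := fun s y => gaussDensityDeriv d s y • f y)
    (bound := fun y => gaussDensityDerivBound d γ y * C)
    (Ioo_mem_nhds (by linarith : γ / 2 < γ) (by linarith : γ < 2 * γ)) ?_ ?_ ?_ ?_ ?_ ?_).2
  · exact Eventually.of_forall fun s =>
      ((continuous_gaussDensity s).smul hf).aestronglyMeasurable
  · exact (integrable_gaussDensity hγ).smul_of_bounded_continuous hf hC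
  · exact ((continuous_gaussDensityDeriv γ).smul hf).aestronglyMeasurable
  · refine Eventually.of_forall fun y s hs => ?_
    rw [norm_smul]
    have := abs_gaussDensityDeriv_le hγ hs y
    exact mul_le_mul this (hC y) (norm_nonneg _) ((abs_nonneg _).trans this)
  · exact (integrable_gaussDensityDerivBound hγ).mul_const C
  · exact Eventually.of_forall fun y s hs =>
      (hasDerivAt_gaussDensity (by linarith [hs.1]) y).smul_const (f y)

theorem integral_gaussDensityDeriv {γ : ℝ} (hγ : 0 < γ) :
    ∫ v, gaussDensityDeriv d γ v = 0 := by
  have h := hasDerivAt_integral_gaussDensity_smul (d := d) (f := fun _ => (1 : ℝ))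
    continuous_const (C := 1) (by simp) hγ
  simp only [smul_eq_mul, mul_one] at h
  refine h.unique ((hasDerivAt_const γ (1 : ℝ)).congr_of_eventuallyEq ?_)
  filter_upwards [lt_mem_nhds hγ] with s hs using integral_gaussDensity hs

theorem sqrt_pow_mul_gaussDensity {γ : ℝ} (hγ : 0 < γ) (z : EuclideanSpace ℝ (Fin d)) :
    √γ ^ d * gaussDensity d γ (√γ • z) = gaussDensity d 1 z := by
  have h1 : √γ ^ d = γ ^ ((d : ℝ) / 2) := by
    rw [Real.sqrt_eq_rpow, ← Real.rpow_natCast, ← Real.rpow_mul hγ.le]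
    ring_nf
  have h2 : ‖√γ • z‖ ^ 2 = γ * ‖z‖ ^ 2 := by
    rw [norm_smul, mul_pow, Real.norm_of_nonneg (Real.sqrt_nonneg _), Real.sq_sqrt hγ.le]
  unfold gaussDensity
  rw [h1, h2, Real.mul_rpow (by positivity) hγ.le, neg_div, Real.rpow_neg hγ.le, mul_one, mul_one]
  have h3 : γ ^ ((d : ℝ) / 2) ≠ 0 := by positivity
  have h4 : -(γ * ‖z‖ ^ 2) / (2 * γ) = -‖z‖ ^ 2 / 2 := by field_simp
  rw [h4]
  field_simp

theorem sqrt_pow_mul_gaussDensityDeriv {γ : ℝ} (hγ : 0 < γ) (z : EuclideanSpace ℝ (Fin d)) :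
    √γ ^ d * (γ * gaussDensityDeriv d γ (√γ • z)) = gaussDensityDeriv d 1 z := by
  have h2 : ‖√γ • z‖ ^ 2 = γ * ‖z‖ ^ 2 := by
    rw [norm_smul, mul_pow, Real.norm_of_nonneg (Real.sqrt_nonneg _), Real.sq_sqrt hγ.le]
  unfold gaussDensityDeriv
  rw [← sqrt_pow_mul_gaussDensity hγ, h2]
  field_simp

/-- Averages against a kernel concentrating at the origin converge to the value at the origin. -/
theorem tendsto_integral_smul_of_rescaling {ψ : EuclideanSpace ℝ (Fin d) → ℝ} (hψ : Integrable ψ)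
    {k : ℝ → EuclideanSpace ℝ (Fin d) → ℝ}
    (hk : ∀ γ, 0 < γ → ∀ z, √γ ^ d * k γ (√γ • z) = ψ z)
    [CompleteSpace E] {f : EuclideanSpace ℝ (Fin d) → E} (hf : Continuous f)
    {C : ℝ} (hC : ∀ y, ‖f y‖ ≤ C) :
    Tendsto (fun γ => ∫ y, k γ y • f y) (𝓝[>] (0 : ℝ)) (𝓝 ((∫ z, ψ z) • f 0)) := by
  have key : Tendsto (fun γ : ℝ => ∫ z, ψ z • f (√γ • z)) (𝓝[>] (0 : ℝ))
      (𝓝 ((∫ z, ψ z) • f 0)) := by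
    rw [← integral_smul_const]
    refine tendsto_integral_filter_of_dominated_convergence (fun z => ‖ψ z‖ * C) ?_ ?_ ?_ ?_
    · exact Eventually.of_forall fun γ => hψ.aestronglyMeasurable.smul
        (Continuous.aestronglyMeasurable (by fun_prop))
    · refine Eventually.of_forall fun γ => Eventually.of_forall fun z => ?_
      rw [norm_smul]
      gcongr
      exact hC _
    · exact hψ.norm.mul_const C
    · refine Eventually.of_forall fun z => ?_
      have hc : Continuous fun γ : ℝ => ψ z • f (√γ • z) := by fun_prop
      have := hc.tendsto 0
      simp only [Real.sqrt_zero, zero_smul] at this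
      exact this.mono_left nhdsWithin_le_nhds
  refine key.congr' ?_
  filter_upwards [self_mem_nhdsWithin] with γ hγ
  have hγ' : 0 < √γ := Real.sqrt_pos.mpr hγ
  have h := Measure.integral_comp_smul (volume : Measure (EuclideanSpace ℝ (Fin d)))
    (fun y => k γ y • f y) (√γ)
  rw [finrank_euclideanSpace_fin, abs_of_pos (by positivity)] at h
  simp_rw [← hk γ hγ, mul_smul]
  rw [integral_smul, h, smul_smul, mul_inv_cancel₀ (by positivity), one_smul]

theorem tendsto_integral_gaussDensity_smul [CompleteSpace E] {f : EuclideanSpace ℝ (Fin d) → E}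
    (hf : Continuous f) {C : ℝ} (hC : ∀ y, ‖f y‖ ≤ C) :
    Tendsto (fun γ => ∫ y, gaussDensity d γ y • f y) (𝓝[>] (0 : ℝ)) (𝓝 (f 0)) := by
  simpa [integral_gaussDensity one_pos] using tendsto_integral_smul_of_rescaling
    (integrable_gaussDensity one_pos) (fun _ hγ z => sqrt_pow_mul_gaussDensity hγ z) hf hC

theorem tendsto_smul_integral_gaussDensityDeriv_smul [CompleteSpace E]
    {f : EuclideanSpace ℝ (Fin d) → E} (hf : Continuous f) {C : ℝ} (hC : ∀ y, ‖f y‖ ≤ C) :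
    Tendsto (fun γ => γ • ∫ y, gaussDensityDeriv d γ y • f y) (𝓝[>] (0 : ℝ)) (𝓝 0) := by
  have h := tendsto_integral_smul_of_rescaling (integrable_gaussDensityDeriv one_pos)
    (k := fun γ y => γ * gaussDensityDeriv d γ y)
    (fun _ hγ z => sqrt_pow_mul_gaussDensityDeriv hγ z) hf hC
  rw [integral_gaussDensityDeriv one_pos, zero_smul] at h
  refine h.congr fun γ => ?_
  simp_rw [mul_smul]
  rw [integral_smul]

theorem gaussConv_eq (p : EuclideanSpace ℝ (Fin d) → ℝ) (γ : ℝ) (x : EuclideanSpace ℝ (Fin d)) :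
    gaussConv d p γ x = ∫ y, gaussDensity d γ y • p (x - y) := by
  rw [gaussConv, ← integral_sub_left_eq_self _ volume x]
  simp [mul_comm]

theorem gaussConv_pos {p : EuclideanSpace ℝ (Fin d) → ℝ} (hpos : ∀ x, 0 < p x)
    (hp : Continuous p) {C : ℝ} (hC : ∀ x, |p x| ≤ C) {γ : ℝ} (hγ : 0 < γ)
    (x : EuclideanSpace ℝ (Fin d)) : 0 < gaussConv d p γ x := by
  have hg : ∀ y, 0 < gaussDensity d γ y := fun y => by unfold gaussDensity; positivity
  rw [gaussConv_eq]
  have hc : Continuous fun y => p (x - y) := by fun_prop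
  exact integral_pos_of_integrable_nonneg_nonzero (x := 0) ((continuous_gaussDensity γ).smul hc)
    ((integrable_gaussDensity hγ).smul_of_bounded_continuous hc fun y => hC _)
    (fun y => (mul_pos (hg y) (hpos _)).le) (mul_pos (hg 0) (hpos _)).ne'

theorem hasGradientAt_gaussConv {p : EuclideanSpace ℝ (Fin d) → ℝ} (hp : ContDiff ℝ 1 p)
    {C : ℝ} (hC : ∀ x, |p x| ≤ C) (hgrad : Continuous (gradient p))
    {C' : ℝ} (hC' : ∀ x, ‖gradient p x‖ ≤ C') {γ : ℝ} (hγ : 0 < γ)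
    (x : EuclideanSpace ℝ (Fin d)) :
    HasGradientAt (gaussConv d p γ) (∫ y, gaussDensity d γ y • gradient p (x - y)) x := by
  let L := (InnerProductSpace.toDual ℝ (EuclideanSpace ℝ (Fin d)))
  have hpd : ∀ y, HasFDerivAt p (L (gradient p y)) y := fun y =>
    ((hp.differentiable one_ne_zero) y).hasGradientAt.hasFDerivAt
  have hpc := hp.continuous
  have hLc : Continuous fun y => L (gradient p (x - y)) := L.continuous.comp (by fun_prop)
  have hd : HasFDerivAt (fun x => ∫ y, gaussDensity d γ y • p (x - y))
      (∫ y, gaussDensity d γ y • L (gradient p (x - y))) x := by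
    refine hasFDerivAt_integral_of_dominated_of_fderiv_le
      (F := fun x y => gaussDensity d γ y • p (x - y))
      (F' := fun x y => gaussDensity d γ y • L (gradient p (x - y)))
      (bound := fun y => ‖gaussDensity d γ y‖ * C') univ_mem ?_ ?_ ?_ ?_ ?_ ?_
    · exact Eventually.of_forall fun x =>
        ((continuous_gaussDensity γ).smul (by fun_prop)).aestronglyMeasurable
    · exact (integrable_gaussDensity hγ).smul_of_bounded_continuous (by fun_prop) fun y => hC _
    · exact ((continuous_gaussDensity γ).smul hLc).aestronglyMeasurable
    · refine Eventually.of_forall fun y x _ => ?_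
      rw [norm_smul, L.norm_map]
      gcongr
      exact hC' _
    · exact (integrable_gaussDensity hγ).norm.mul_const C'
    · exact Eventually.of_forall fun y x _ =>
        ((hasFDerivAt_comp_sub y).mpr (hpd (x - y))).const_smul (gaussDensity d γ y)
  rw [hasGradientAt_iff_hasFDerivAt, funext (gaussConv_eq p γ)]
  refine hd.congr_fderiv (Eq.symm ?_)
  have hi := L.toContinuousLinearEquiv.toContinuousLinearMap.integral_comp_comm
    ((integrable_gaussDensity hγ).smul_of_bounded_continuous
      (f := fun y => gradient p (x - y)) (by fun_prop) fun y => hC' _)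
  refine hi.symm.trans (integral_congr_ae (Eventually.of_forall fun y => ?_))
  exact L.toContinuousLinearEquiv.toContinuousLinearMap.map_smul _ _

theorem gradient_log {F : Type*} [NormedAddCommGroup F] [InnerProductSpace ℝ F] [CompleteSpace F]
    {q : F → ℝ} {v x : F} (hq : HasGradientAt q v x) (hx : q x ≠ 0) :
    gradient (fun y => Real.log (q y)) x = (q x)⁻¹ • v := by
  refine HasGradientAt.gradient ?_
  rw [hasGradientAt_iff_hasFDerivAt]
  refine (hq.hasFDerivAt.log hx).congr_fderiv ?_
  ext w
  simp

end GaussianSmoothing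

/-- For a continuously differentiable, everywhere positive probability density `p` with `p` and
`∇p` bounded (and continuous), the extended score
`H_γ p (x) = (1+γ)·∇ₓ log(p*g_γ)(x) + γ·(d/dγ)∇ₓ log(p*g_γ)(x)` converges, as `γ → 0⁺`,
to the score `∇ log p (x)`. -/
theorem extended_score_extends_score (d : ℕ) (p : EuclideanSpace ℝ (Fin d) → ℝ)
    (hsmooth : ContDiff ℝ 1 p) (hpos : ∀ x, 0 < p x) (hprob : ∫ x, p x = 1)
    (hpcont : Continuous p) (hpbdd : ∃ C, ∀ x, |p x| ≤ C)
    (hgradcont : Continuous (gradient p)) (hgradbdd : ∃ C, ∀ x, ‖gradient p x‖ ≤ C)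
    (x : EuclideanSpace ℝ (Fin d)) :
    Tendsto (fun γ : ℝ =>
        (1 + γ) • gradient (fun y => Real.log (gaussConv d p γ y)) x
          + γ • deriv (fun s : ℝ => gradient (fun y => Real.log (gaussConv d p s y)) x) γ)
      (𝓝[>] (0 : ℝ)) (𝓝 (gradient (fun y => Real.log (p y)) x)) := by
  obtain ⟨C, hC⟩ := hpbdd
  obtain ⟨C', hC'⟩ := hgradbdd
  set q : ℝ → ℝ := fun s => ∫ y, gaussDensity d s y • p (x - y)
  set G : ℝ → EuclideanSpace ℝ (Fin d) := fun s => ∫ y, gaussDensity d s y • gradient p (x - y)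
  set q' : ℝ → ℝ := fun s => ∫ y, gaussDensityDeriv d s y • p (x - y)
  set G' : ℝ → EuclideanSpace ℝ (Fin d) :=
    fun s => ∫ y, gaussDensityDeriv d s y • gradient p (x - y)
  have hpc : Continuous fun y => p (x - y) := by fun_prop
  have hgc : Continuous fun y => gradient p (x - y) := by fun_prop
  have hq0 : Tendsto q (𝓝[>] 0) (𝓝 (p x)) := by
    have h := tendsto_integral_gaussDensity_smul hpc (C := C) fun y => hC _
    rwa [sub_zero] at h
  have hG0 : Tendsto G (𝓝[>] 0) (𝓝 (gradient p x)) := by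
    simpa using tendsto_integral_gaussDensity_smul hgc fun y => hC' _
  have hq'0 : Tendsto (fun γ => γ • q' γ) (𝓝[>] 0) (𝓝 0) :=
    tendsto_smul_integral_gaussDensityDeriv_smul hpc (C := C) fun y => hC _
  have hG'0 : Tendsto (fun γ => γ • G' γ) (𝓝[>] 0) (𝓝 0) :=
    tendsto_smul_integral_gaussDensityDeriv_smul hgc fun y => hC' _
  have hqpos : ∀ s, 0 < s → 0 < q s := fun s hs => by
    exact (gaussConv_pos hpos hpcont hC hs x).trans_eq (gaussConv_eq p s x)
  have hscore : ∀ s, 0 < s →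
      gradient (fun y => Real.log (gaussConv d p s y)) x = (q s)⁻¹ • G s := fun s hs => by
    rw [gradient_log (hasGradientAt_gaussConv hsmooth hC hgradcont hC' hs x)
      (gaussConv_pos hpos hpcont hC hs x).ne', gaussConv_eq]
  have hderiv : ∀ s, 0 < s →
      deriv (fun s : ℝ => gradient (fun y => Real.log (gaussConv d p s y)) x) s
        = (q s)⁻¹ • G' s + (-q' s / q s ^ 2) • G s := fun s hs => by
    have h1 : HasDerivAt q (q' s) s :=
      hasDerivAt_integral_gaussDensity_smul hpc (C := C) (fun y => hC _) hs
    have h2 : HasDerivAt G (G' s) s :=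
      hasDerivAt_integral_gaussDensity_smul hgc (fun y => hC' _) hs
    refine (((h1.inv (hqpos s hs).ne').smul h2).congr_of_eventuallyEq ?_).deriv
    filter_upwards [lt_mem_nhds hs] with t ht using hscore t ht
  rw [gradient_log ((hsmooth.differentiable one_ne_zero) x).hasGradientAt (hpos x).ne']
  have hinv := hq0.inv₀ (hpos x).ne'
  have hid : Tendsto (fun γ : ℝ => 1 + γ) (𝓝[>] 0) (𝓝 (1 + 0)) :=
    (tendsto_const_nhds.add tendsto_id).mono_left nhdsWithin_le_nhds
  have hlim := (hid.smul (hinv.smul hG0)).add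
    ((hinv.smul hG'0).sub (((hq'0.mul hinv).mul hinv).smul hG0))
  simp only [add_zero, one_smul, smul_zero, zero_mul, zero_smul, sub_zero] at hlim
  refine hlim.congr' ?_
  filter_upwards [self_mem_nhdsWithin] with γ hγ
  rw [hscore γ hγ, hderiv γ hγ, smul_add, smul_smul γ, smul_smul γ, smul_smul (q γ)⁻¹ γ,
    sub_eq_add_neg, ← neg_smul, smul_eq_mul]
  congr 2
  · congr 1
    ring
  · congr 1
    field_simp
end

section
/- Let f : ℝ^d → ℝ be bounded and continuous, and for γ > 0 let h_γ(x) = (‖x‖²/γ)·g_γ(x). Then for every x ∈ ℝ^d, lim_{γ→0} (f*h_γ)(x) = d·f(x), where d = ∫_{ℝ^d} (2π)^{-d/2} ‖z‖² e^{-‖z‖²/2} dz is the second moment of the standard Gaussian on ℝ^d. -/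
open MeasureTheory Filter Real Topology

/-- The kernel `h_γ(x) = (‖x‖²/γ)·g_γ(x)`. -/
noncomputable def hKernel (d : ℕ) (γ : ℝ) (x : EuclideanSpace ℝ (Fin d)) : ℝ :=
  (‖x‖ ^ 2 / γ) * gaussDensity d γ x

theorem sq_norm_mul_exp_le {V : Type*} [NormedAddCommGroup V] {b : ℝ} (hb : 0 < b) (v : V) :
    ‖v‖ ^ 2 * Real.exp (-b * ‖v‖ ^ 2) ≤ (2 / b) * Real.exp (-(b / 2) * ‖v‖ ^ 2) := by
  have h : ‖v‖ ^ 2 ≤ (2 / b) * Real.exp (b / 2 * ‖v‖ ^ 2) := by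
    have h1 := Real.add_one_le_exp (b / 2 * ‖v‖ ^ 2)
    calc ‖v‖ ^ 2 = (2 / b) * (b / 2 * ‖v‖ ^ 2) := by field_simp
      _ ≤ _ := by gcongr; linarith
  calc ‖v‖ ^ 2 * Real.exp (-b * ‖v‖ ^ 2)
      ≤ (2 / b) * Real.exp (b / 2 * ‖v‖ ^ 2) * Real.exp (-b * ‖v‖ ^ 2) := by gcongr
    _ = _ := by
      rw [mul_assoc, ← Real.exp_add]
      ring_nf

section GaussianSecondMoment

variable {V : Type*} [NormedAddCommGroup V] [InnerProductSpace ℝ V] [FiniteDimensional ℝ V]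
  [MeasurableSpace V] [BorelSpace V]

theorem integrable_exp_neg_mul_sq_norm {b : ℝ} (hb : 0 < b) :
    Integrable (fun v : V => Real.exp (-b * ‖v‖ ^ 2)) := by
  apply Integrable.of_integral_ne_zero
  rw [GaussianFourier.integral_rexp_neg_mul_sq_norm hb]
  positivity

theorem integrable_sq_norm_mul_exp {b : ℝ} (hb : 0 < b) :
    Integrable (fun v : V => ‖v‖ ^ 2 * Real.exp (-b * ‖v‖ ^ 2)) := by
  refine ((integrable_exp_neg_mul_sq_norm (V := V) (half_pos hb)).const_mul (2 / b)).mono'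
    (by fun_prop) (ae_of_all _ fun v => ?_)
  rw [Real.norm_of_nonneg (by positivity)]
  exact sq_norm_mul_exp_le hb v

theorem integral_sq_norm_mul_exp {b : ℝ} (hb : 0 < b) :
    ∫ v : V, ‖v‖ ^ 2 * Real.exp (-b * ‖v‖ ^ 2) =
      (π / b) ^ (Module.finrank ℝ V / 2 : ℝ) * (Module.finrank ℝ V / (2 * b)) := by
  have hderiv := (hasDerivAt_integral_of_dominated_loc_of_deriv_le
    (μ := (volume : Measure V)) (x₀ := b) (s := Set.Ioi (b / 2))
    (F := fun c v => Real.exp (-c * ‖v‖ ^ 2))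
    (F' := fun c v => -(‖v‖ ^ 2 * Real.exp (-c * ‖v‖ ^ 2)))
    (bound := fun v => ‖v‖ ^ 2 * Real.exp (-(b / 2) * ‖v‖ ^ 2))
    (Ioi_mem_nhds (half_lt_self hb))
    (Eventually.of_forall fun c => by fun_prop)
    (integrable_exp_neg_mul_sq_norm hb) (by fun_prop)
    (ae_of_all _ fun v c hc => by
      rw [norm_neg, Real.norm_of_nonneg (by positivity)]
      have : b / 2 ≤ c := le_of_lt hc
      gcongr)
    (integrable_sq_norm_mul_exp (half_pos hb))
    (ae_of_all _ fun v c _ => by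
      convert! ((hasDerivAt_id c).neg.mul_const (‖v‖ ^ 2)).exp using 1
      simp
      ring)).2
  have hclosed : HasDerivAt (fun c : ℝ => ∫ v : V, Real.exp (-c * ‖v‖ ^ 2))
      (-((π / b) ^ (Module.finrank ℝ V / 2 : ℝ) * (Module.finrank ℝ V / (2 * b)))) b := by
    have h := ((hasDerivAt_inv hb.ne').const_mul π).rpow_const
      (p := (Module.finrank ℝ V / 2 : ℝ)) (Or.inl (by positivity))
    refine HasDerivAt.congr_of_eventuallyEq (h.congr_deriv ?_) ?_
    · rw [Real.rpow_sub_one (by positivity), div_eq_mul_inv π b]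
      field_simp
    · filter_upwards [Ioi_mem_nhds hb] with c hc
      rw [GaussianFourier.integral_rexp_neg_mul_sq_norm hc, div_eq_mul_inv]
  have h := hderiv.unique hclosed
  rwa [integral_neg, neg_inj] at h

end GaussianSecondMoment

theorem integral_stdGaussian_sq_norm (d : ℕ) :
    (∫ z : EuclideanSpace ℝ (Fin d),
      (2 * π) ^ (-(d : ℝ) / 2) * ‖z‖ ^ 2 * Real.exp (-‖z‖ ^ 2 / 2)) = (d : ℝ) := by
  have h := integral_sq_norm_mul_exp (V := EuclideanSpace ℝ (Fin d)) (b := 1 / 2) (by norm_num)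
  have hexp : ∀ z : EuclideanSpace ℝ (Fin d), -‖z‖ ^ 2 / 2 = -(1 / 2) * ‖z‖ ^ 2 :=
    fun z => by ring
  simp_rw [mul_assoc ((2 * π) ^ (-(d : ℝ) / 2)), hexp]
  rw [integral_const_mul, h, finrank_euclideanSpace_fin, ← mul_assoc,
    show π / (1 / 2) = 2 * π by ring, ← Real.rpow_add (by positivity)]
  simp [neg_div]

theorem integrable_stdGaussian_sq_norm (d : ℕ) :
    Integrable fun z : EuclideanSpace ℝ (Fin d) =>
      (2 * π) ^ (-(d : ℝ) / 2) * ‖z‖ ^ 2 * Real.exp (-‖z‖ ^ 2 / 2) := by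
  refine ((integrable_sq_norm_mul_exp (V := EuclideanSpace ℝ (Fin d)) (b := 1 / 2)
    (by norm_num)).const_mul ((2 * π) ^ (-(d : ℝ) / 2))).congr (ae_of_all _ fun z => ?_)
  simp only [mul_assoc]
  ring_nf

theorem sqrt_pow_mul_hKernel_sqrt_smul (d : ℕ) {γ : ℝ} (hγ : 0 < γ)
    (z : EuclideanSpace ℝ (Fin d)) :
    √γ ^ d * hKernel d γ (√γ • z) =
      (2 * π) ^ (-(d : ℝ) / 2) * ‖z‖ ^ 2 * Real.exp (-‖z‖ ^ 2 / 2) := by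
  have hnorm : ‖√γ • z‖ ^ 2 = γ * ‖z‖ ^ 2 := by
    rw [norm_smul, mul_pow, Real.norm_of_nonneg (Real.sqrt_nonneg γ), Real.sq_sqrt hγ.le]
  have hscale : √γ ^ d * γ ^ (-(d : ℝ) / 2) = 1 := by
    rw [Real.sqrt_eq_rpow, ← Real.rpow_natCast, ← Real.rpow_mul hγ.le, ← Real.rpow_add hγ,
      show 1 / 2 * (d : ℝ) + -(d : ℝ) / 2 = 0 by ring, Real.rpow_zero]
  rw [hKernel, gaussDensity, hnorm, Real.mul_rpow (by positivity) hγ.le,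
    mul_div_cancel_left₀ _ hγ.ne', show -(γ * ‖z‖ ^ 2) / (2 * γ) = -‖z‖ ^ 2 / 2 by field_simp]
  linear_combination
    ((2 * π) ^ (-(d : ℝ) / 2) * ‖z‖ ^ 2 * Real.exp (-‖z‖ ^ 2 / 2)) * hscale

theorem conv_hKernel_eq_integral (d : ℕ) (f : EuclideanSpace ℝ (Fin d) → ℝ)
    (x : EuclideanSpace ℝ (Fin d)) {γ : ℝ} (hγ : 0 < γ) :
    ∫ y, f y * hKernel d γ (x - y) =
      ∫ z, f (x - √γ • z) *
        ((2 * π) ^ (-(d : ℝ) / 2) * ‖z‖ ^ 2 * Real.exp (-‖z‖ ^ 2 / 2)) := by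
  have hpow : 0 < √γ ^ d := pow_pos (Real.sqrt_pos.2 hγ) d
  have hscale := Measure.integral_comp_smul volume
    (fun u : EuclideanSpace ℝ (Fin d) => f (x - u) * hKernel d γ u) (√γ)
  rw [finrank_euclideanSpace_fin, abs_of_pos (inv_pos.2 hpow), smul_eq_mul] at hscale
  calc ∫ y, f y * hKernel d γ (x - y)
      = ∫ u, f (x - u) * hKernel d γ u := by
        simpa using (integral_sub_left_eq_self
          (fun y => f y * hKernel d γ (x - y)) volume x).symm
    _ = √γ ^ d * ∫ z, f (x - √γ • z) * hKernel d γ (√γ • z) := by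
        rw [hscale, mul_inv_cancel_left₀ hpow.ne']
    _ = _ := by
        rw [← integral_const_mul]
        refine integral_congr_ae (ae_of_all _ fun z => ?_)
        simp only [← sqrt_pow_mul_hKernel_sqrt_smul d hγ z]
        ring

/-- For `f` bounded and continuous, `lim_{γ→0⁺} (f * h_γ)(x) = d · f(x)`, where
`d = ∫ (2π)^{-d/2} ‖z‖² e^{-‖z‖²/2} dz` is the second moment of the standard Gaussian on `ℝ^d`. -/
theorem conv_hKernel_tendsto (d : ℕ) (f : EuclideanSpace ℝ (Fin d) → ℝ)
    (hfcont : Continuous f) (hfbdd : ∃ C, ∀ x, |f x| ≤ C) (x : EuclideanSpace ℝ (Fin d)) :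
    (∫ z : EuclideanSpace ℝ (Fin d),
        (2 * π) ^ (-(d : ℝ) / 2) * ‖z‖ ^ 2 * Real.exp (-‖z‖ ^ 2 / 2)) = (d : ℝ) ∧
    Tendsto (fun γ : ℝ => ∫ y, f y * hKernel d γ (x - y))
      (𝓝[>] (0 : ℝ)) (𝓝 ((d : ℝ) * f x)) := by
  refine ⟨integral_stdGaussian_sq_norm d, ?_⟩
  obtain ⟨C, hC⟩ := hfbdd
  suffices h : Tendsto (fun γ : ℝ => ∫ z, f (x - √γ • z) *
      ((2 * π) ^ (-(d : ℝ) / 2) * ‖z‖ ^ 2 * Real.exp (-‖z‖ ^ 2 / 2)))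
      (𝓝[>] (0 : ℝ)) (𝓝 ((d : ℝ) * f x)) by
    refine h.congr' ?_
    filter_upwards [self_mem_nhdsWithin] with γ hγ
    exact (conv_hKernel_eq_integral d f x hγ).symm
  have hlimit : (d : ℝ) * f x = ∫ z : EuclideanSpace ℝ (Fin d),
      f x * ((2 * π) ^ (-(d : ℝ) / 2) * ‖z‖ ^ 2 * Real.exp (-‖z‖ ^ 2 / 2)) := by
    rw [integral_const_mul, integral_stdGaussian_sq_norm, mul_comm]
  rw [hlimit]
  refine tendsto_integral_filter_of_dominated_convergence
    (fun z => C * ((2 * π) ^ (-(d : ℝ) / 2) * ‖z‖ ^ 2 * Real.exp (-‖z‖ ^ 2 / 2)))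
    (Eventually.of_forall fun γ => by fun_prop) (Eventually.of_forall fun γ => ?_)
    ((integrable_stdGaussian_sq_norm d).const_mul C) (ae_of_all _ fun z => ?_)
  · refine ae_of_all _ fun z => ?_
    rw [norm_mul, Real.norm_of_nonneg (r := _ * _) (by positivity)]
    gcongr
    exact hC _
  · refine Tendsto.mul_const _ (Tendsto.mono_left ?_ nhdsWithin_le_nhds)
    have hcont : Continuous fun γ : ℝ => f (x - √γ • z) := by fun_prop
    simpa using hcont.tendsto 0
end

section
/- Let n ∈ ℕ, μ_1,…,μ_n ∈ ℝ^d, and c_1,…,c_n > 0 with Σ_i c_i = 1, and let p = Σ_{i=1}^n c_i δ_{μ_i}. Then for every x ∈ ℝ^d, lim_{γ→0} (d/dγ)[γ·∇_x log(p*g_γ)(x)] = 0. -/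
open MeasureTheory Filter Real Topology

/-- The density `(p * g_γ)(x) = ∫ g_γ(x - y) dp(y)` of a probability measure `p`
convolved with the Gaussian `N(0, γ I)`. -/
noncomputable def measGaussConv (d : ℕ) (p : Measure (EuclideanSpace ℝ (Fin d))) (γ : ℝ)
    (x : EuclideanSpace ℝ (Fin d)) : ℝ :=
  ∫ y, gaussDensity d γ (x - y) ∂p

lemma measGaussConv_sum_dirac (d : ℕ) {ι : Type*} [Fintype ι] (μ : ι → EuclideanSpace ℝ (Fin d))
    (c : ι → ℝ) (hc : ∀ i, 0 ≤ c i) (s : ℝ) (y : EuclideanSpace ℝ (Fin d)) :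
    measGaussConv d (∑ i, ENNReal.ofReal (c i) • Measure.dirac (μ i)) s y
      = ∑ i, c i * gaussDensity d s (y - μ i) := by
  unfold measGaussConv
  rw [integral_finsetSum_measure]
  · refine Finset.sum_congr rfl fun i _ => ?_
    rw [integral_smul_measure, integral_dirac, ENNReal.toReal_ofReal (hc i), smul_eq_mul]
  · intro i _
    exact (integrable_dirac (by simp)).smul_measure ENNReal.ofReal_ne_top

lemma hasGradientAt_gaussDensity_sub (d : ℕ) {s : ℝ} (hs : 0 < s)
    (m x : EuclideanSpace ℝ (Fin d)) :
    HasGradientAt (fun y => gaussDensity d s (y - m))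
      ((gaussDensity d s (x - m) * s⁻¹) • (m - x)) x := by
  rw [hasGradientAt_iff_hasFDerivAt]
  have h := (((hasFDerivAt_id x).sub_const m).norm_sq.neg.mul_const (2 * s)⁻¹).exp.const_mul
    ((2 * π * s) ^ (-(d : ℝ) / 2))
  simp only [gaussDensity, div_eq_mul_inv _ (2 * s)]
  refine h.congr_fderiv ?_
  ext v
  simp
  field_simp
  ring

lemma gaussDensity_pos (d : ℕ) {s : ℝ} (hs : 0 < s) (x : EuclideanSpace ℝ (Fin d)) :
    0 < gaussDensity d s x := by
  unfold gaussDensity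
  positivity

/-- The rescaled score of a Gaussian mixture is a softmax average of the displacements. -/
lemma smul_gradient_log_mixture (d : ℕ) {ι : Type*} [Fintype ι] [Nonempty ι]
    (μ : ι → EuclideanSpace ℝ (Fin d)) (c : ι → ℝ) (hc : ∀ i, 0 < c i)
    (x : EuclideanSpace ℝ (Fin d)) (m : ℝ) {s : ℝ} (hs : 0 < s) :
    s • gradient (fun y => Real.log (∑ i, c i * gaussDensity d s (y - μ i))) x
      = (∑ i, c i * Real.exp (-((‖x - μ i‖ ^ 2 - m) / 2) / s))⁻¹ •
        ∑ i, Real.exp (-((‖x - μ i‖ ^ 2 - m) / 2) / s) • c i • (μ i - x) := by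
  have hS : 0 < ∑ i, c i * gaussDensity d s (x - μ i) :=
    Finset.sum_pos (fun i _ => mul_pos (hc i) (gaussDensity_pos d hs _)) Finset.univ_nonempty
  have hg : HasGradientAt (fun y => Real.log (∑ i, c i * gaussDensity d s (y - μ i)))
      ((∑ i, c i * gaussDensity d s (x - μ i))⁻¹ •
        ∑ i, c i • ((gaussDensity d s (x - μ i) * s⁻¹) • (μ i - x))) x := by
    rw [hasGradientAt_iff_hasFDerivAt]
    have h := (HasFDerivAt.fun_sum (u := Finset.univ) fun i _ =>
      ((hasGradientAt_gaussDensity_sub d hs (μ i) x).hasFDerivAt.const_mul (c i))).log hS.ne'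
    refine h.congr_fderiv ?_
    simp [map_sum]
  obtain ⟨K, hK, hKe⟩ : ∃ K : ℝ, 0 < K ∧ ∀ i, gaussDensity d s (x - μ i)
      = K * Real.exp (-((‖x - μ i‖ ^ 2 - m) / 2) / s) := by
    refine ⟨(2 * π * s) ^ (-(d : ℝ) / 2) * Real.exp (-m / (2 * s)), by positivity, fun i => ?_⟩
    rw [gaussDensity, mul_assoc _ (Real.exp _), ← Real.exp_add]
    congr 2
    field_simp
    ring
  rw [hg.gradient]
  simp only [hKe, mul_left_comm _ K, ← Finset.mul_sum]
  rw [smul_comm, Finset.smul_sum, Finset.smul_sum, Finset.smul_sum]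
  refine Finset.sum_congr rfl fun i _ => ?_
  simp only [smul_smul]
  congr 1
  field_simp

lemma hasDerivAt_exp_neg_div (b : ℝ) {s : ℝ} (hs : 0 < s) :
    HasDerivAt (fun t => Real.exp (-b / t)) (b / s ^ 2 * Real.exp (-b / s)) s := by
  have h := ((hasDerivAt_inv hs.ne').const_mul (-b)).exp
  simp only [← div_eq_mul_inv] at h
  convert h using 1
  field_simp

lemma tendsto_div_nhdsGT_zero {b : ℝ} (hb : 0 < b) :
    Tendsto (fun s : ℝ => b / s) (𝓝[>] 0) atTop := by
  simpa only [div_eq_mul_inv] using tendsto_inv_nhdsGT_zero.const_mul_atTop hb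

lemma tendsto_exp_neg_div_nhdsGT_zero {b : ℝ} (hb : 0 ≤ b) :
    Tendsto (fun s : ℝ => Real.exp (-b / s)) (𝓝[>] 0) (𝓝 (if b = 0 then 1 else 0)) := by
  split_ifs with h
  · simp [h]
  · simpa only [neg_div, Function.comp_def] using Real.tendsto_exp_neg_atTop_nhds_zero.comp
      (tendsto_div_nhdsGT_zero (hb.lt_of_ne' h))

lemma tendsto_deriv_exp_neg_div_nhdsGT_zero {b : ℝ} (hb : 0 ≤ b) :
    Tendsto (fun s : ℝ => b / s ^ 2 * Real.exp (-b / s)) (𝓝[>] 0) (𝓝 0) := by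
  rcases hb.eq_or_lt with rfl | hb
  · simp
  · have h := ((Real.tendsto_pow_mul_exp_neg_atTop_nhds_zero 2).comp
      (tendsto_div_nhdsGT_zero hb)).const_mul b⁻¹
    rw [mul_zero] at h
    refine h.congr fun s => ?_
    simp only [Function.comp_apply, neg_div]
    field_simp

/-- Softmax averages with nonnegative energies, one of them zero, have derivative tending to zero
as the temperature tends to zero. -/
lemma tendsto_deriv_softmax_average {E ι : Type*} [NormedAddCommGroup E] [NormedSpace ℝ E]
    [Fintype ι] (c b : ι → ℝ) (v : ι → E) (hc : ∀ i, 0 < c i) (hb : ∀ i, 0 ≤ b i) {i₀ : ι}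
    (hi₀ : b i₀ = 0) :
    Tendsto (deriv fun s : ℝ => (∑ i, c i * Real.exp (-b i / s))⁻¹ •
      ∑ i, Real.exp (-b i / s) • v i) (𝓝[>] 0) (𝓝 0) := by
  have hF := tendsto_finsetSum Finset.univ fun i _ =>
    (tendsto_exp_neg_div_nhdsGT_zero (hb i)).const_mul (c i)
  have hN := tendsto_finsetSum Finset.univ fun i _ =>
    (tendsto_exp_neg_div_nhdsGT_zero (hb i)).smul_const (v i)
  have hF' := tendsto_finsetSum Finset.univ fun i _ =>
    (tendsto_deriv_exp_neg_div_nhdsGT_zero (hb i)).const_mul (c i)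
  have hN' := tendsto_finsetSum Finset.univ fun i _ =>
    (tendsto_deriv_exp_neg_div_nhdsGT_zero (hb i)).smul_const (v i)
  have hF0 : (∑ i, c i * if b i = 0 then (1 : ℝ) else 0) ≠ 0 := by
    refine (Finset.sum_pos' (fun i _ => ?_) ⟨i₀, Finset.mem_univ _, ?_⟩).ne'
    · have := hc i
      split_ifs <;> simp [this.le]
    · simp [hi₀, hc i₀]
  have h := ((hF.inv₀ hF0).smul hN').add
    (((hF'.neg.div (hF.pow 2) (pow_ne_zero 2 hF0))).smul hN)
  simp only [zero_smul, mul_zero, Finset.sum_const_zero, smul_zero, neg_zero, zero_div,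
    add_zero] at h
  refine h.congr' ?_
  filter_upwards [self_mem_nhdsWithin] with s hs
  have hSpos : 0 < ∑ i, c i * Real.exp (-b i / s) :=
    Finset.sum_pos (fun i _ => mul_pos (hc i) (Real.exp_pos _)) ⟨i₀, Finset.mem_univ _⟩
  have hd := ((HasDerivAt.fun_sum (u := Finset.univ) fun i _ =>
      (hasDerivAt_exp_neg_div (b i) hs).const_mul (c i)).fun_inv hSpos.ne').fun_smul
    (HasDerivAt.fun_sum (u := Finset.univ) fun i _ =>
      (hasDerivAt_exp_neg_div (b i) hs).smul_const (v i))
  exact hd.deriv.symm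

/-- For the Dirac mixture `p = Σ_i c_i δ_{μ_i}`,
`lim_{γ→0⁺} (d/dγ)[γ·∇ₓ log(p*g_γ)(x)] = 0` for every `x ∈ ℝ^d`. -/
theorem deriv_gamma_score_tendsto_zero (d n : ℕ) (μ : Fin n → EuclideanSpace ℝ (Fin d))
    (c : Fin n → ℝ) (hc : ∀ i, 0 < c i) (hsum : ∑ i, c i = 1)
    (x : EuclideanSpace ℝ (Fin d)) :
    Tendsto (fun γ : ℝ =>
        deriv (fun s : ℝ => s • gradient (fun y => Real.log
          (measGaussConv d (∑ i, ENNReal.ofReal (c i) • Measure.dirac (μ i)) s y)) x) γ)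
      (𝓝[>] (0 : ℝ)) (𝓝 (0 : EuclideanSpace ℝ (Fin d))) := by
  have hn : Nonempty (Fin n) := by
    by_contra h
    rw [not_nonempty_iff] at h
    simp at hsum
  obtain ⟨i₀, hi₀⟩ := Finite.exists_min fun i => ‖x - μ i‖ ^ 2
  refine (tendsto_deriv_softmax_average c (fun i => (‖x - μ i‖ ^ 2 - ‖x - μ i₀‖ ^ 2) / 2)
    (fun i => c i • (μ i - x)) hc (fun i => by linarith [hi₀ i]) (i₀ := i₀) (by simp)).congr' ?_
  filter_upwards [self_mem_nhdsWithin] with γ hγ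
  refine Filter.EventuallyEq.deriv_eq ?_
  filter_upwards [lt_mem_nhds hγ] with s hs
  simp only [measGaussConv_sum_dirac d μ c fun i => (hc i).le]
  exact (smul_gradient_log_mixture d μ c hc x _ hs).symm
end

section
/- Fix μ ∈ ℝ^d and let S_θ(σ, x) = −(x−μ)/σ², so that (∂/∂σ) S_θ(σ, x) = 2(x−μ)/σ³. Let b > 0, t_{i+1} < t_i with t_i > 0, γ_i > 0 with 1 + γ_i − bγ_i/t_i² ≠ 0, and set m_i = (1 + γ_i − bγ_i/t_i²)^{-1}. Then the update x_{i+1} = x_i − m_i (t_{i+1}−t_i) t_i [ (1+γ_i) S_θ(t_i, x_i) + (bγ_i/(2t_i)) (∂/∂σ)S_θ(t_i, x_i) ] equals x_{i+1} = (1 − (t_i−t_{i+1})/t_i) x_i + ((t_i−t_{i+1})/t_i) μ, i.e. it coincides with the standard-score Euler step for the Dirac delta at μ. -/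
open Filter Topology

/-- For the score `S_θ(σ, x) = -(x-μ)/σ²` of a Dirac delta at `μ` (whose `σ`-derivative is
`2(x-μ)/σ³`), the extended-score update with correction factor
`m_i = (1 + γ_i - bγ_i/t_i²)⁻¹` coincides with the standard-score Euler step
`x_{i+1} = (1 - (t_i - t_{i+1})/t_i)·x_i + ((t_i - t_{i+1})/t_i)·μ`. -/
theorem extended_score_step_dirac (d : ℕ) (μ : EuclideanSpace ℝ (Fin d))
    (b : ℝ) (hb : 0 < b) (ti ti1 : ℝ) (hti : 0 < ti) (hlt : ti1 < ti)
    (γi : ℝ) (hγi : 0 < γi) (hm : 1 + γi - b * γi / ti ^ 2 ≠ 0)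
    (xi : EuclideanSpace ℝ (Fin d)) :
    (∀ x : EuclideanSpace ℝ (Fin d), ∀ σ : ℝ, σ ≠ 0 →
        deriv (fun s : ℝ => -(s ^ 2)⁻¹ • (x - μ)) σ = (2 / σ ^ 3) • (x - μ)) ∧
    xi - ((1 + γi - b * γi / ti ^ 2)⁻¹ * ((ti1 - ti) * ti)) •
        ((1 + γi) • (-(ti ^ 2)⁻¹ • (xi - μ)) + (b * γi / (2 * ti)) • ((2 / ti ^ 3) • (xi - μ)))
      = (1 - (ti - ti1) / ti) • xi + ((ti - ti1) / ti) • μ := by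
  refine ⟨fun x σ hσ => ?_, ?_⟩
  · have h : HasDerivAt (fun s : ℝ => -(s ^ 2)⁻¹) (2 / σ ^ 3) σ := by
      refine ((hasDerivAt_pow 2 σ).inv (pow_ne_zero 2 hσ)).neg.congr_deriv ?_
      field_simp
      ring
    exact (h.smul_const (x - μ)).deriv
  · have ht : ti ≠ 0 := hti.ne'
    have key : (1 + γi - b * γi / ti ^ 2)⁻¹ * ((ti1 - ti) * ti) *
        ((1 + γi) * -(ti ^ 2)⁻¹ + b * γi / (2 * ti) * (2 / ti ^ 3)) = (ti - ti1) / ti := by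
      have hfactor : (1 + γi) * -(ti ^ 2)⁻¹ + b * γi / (2 * ti) * (2 / ti ^ 3)
          = (1 + γi - b * γi / ti ^ 2) * -(ti ^ 2)⁻¹ := by
        field_simp
        ring
      rw [hfactor, mul_mul_mul_comm, inv_mul_cancel₀ hm]
      field_simp
      ring
    rw [smul_smul, smul_smul, ← add_smul, smul_smul, key]
    module
end
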